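/- Let p, q ≥ 2 be coprime integers. Then 0 < 3·Σ_{i=1}^{p−1} Σ_{j=1}^{q−1} ( 1 − 2·|i/p + j/q − 1| ) − (p−1)(q−1) − ( p + q − p/q − q/p − 1 ) < 2/9. -/

import Mathlib

theorem sum_Icc_one_pred_eq (f : ℕ → ℝ) {n : ℕ} (hn : 1 ≤ n) :
    ∑ i ∈ Finset.Icc 1 (n - 1), f i = ∑ i ∈ Finset.range n, f i - f 0 := by
  have h : Finset.Icc 1 (n - 1) = Finset.Ico 1 n := by
    ext i; simp only [Finset.mem_Icc, Finset.mem_Ico]; omega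
  rw [h, Finset.range_eq_Ico, Finset.sum_eq_sum_Ico_succ_bot (by omega : 0 < n)]
  ring

theorem sum_range_cast (n : ℕ) :
    ∑ i ∈ Finset.range n, (i : ℝ) = n * (n - 1) / 2 := by
  induction n with
  | zero => simp
  | succ k ih => rw [Finset.sum_range_succ, ih]; push_cast; ring

theorem sum_range_cast_sq (n : ℕ) :
    ∑ i ∈ Finset.range n, (i : ℝ) ^ 2 = n * (n - 1) * (2 * n - 1) / 6 := by
  induction n with
  | zero => simp
  | succ k ih => rw [Finset.sum_range_succ, ih]; push_cast; ring

theorem sum_range_abs_sub_of_le {t : ℝ} {n : ℕ} (h : (n : ℝ) ≤ t + 1) :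
    ∑ j ∈ Finset.range n, |(j : ℝ) - t| = n * t - n * (n - 1) / 2 := by
  have h' : ∀ j ∈ Finset.range n, |(j : ℝ) - t| = t - j := by
    intro j hj
    have : ((j + 1 : ℕ) : ℝ) ≤ n := by exact_mod_cast Finset.mem_range.1 hj
    push_cast at this
    rw [abs_of_nonpos (by linarith)]
    ring
  rw [Finset.sum_congr rfl h', Finset.sum_sub_distrib, sum_range_cast]
  simp

/-- The sum of the distances from `m + f` to the integers `0, …, q - 1`, where `f` is the
fractional part. -/
theorem sum_range_abs_sub {m q : ℕ} {f : ℝ} (hf0 : 0 ≤ f) (hf1 : f ≤ 1) (hmq : m < q) :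
    ∑ j ∈ Finset.range q, |(j : ℝ) - (m + f)| =
      (m + f) + (m + f) ^ 2 - q * (m + f) + f - f ^ 2 + q * (q - 1) / 2 := by
  obtain ⟨k, rfl⟩ := Nat.exists_eq_add_of_lt hmq
  induction k with
  | zero =>
    rw [sum_range_abs_sub_of_le (by push_cast; linarith)]
    push_cast
    ring
  | succ k ih =>
    rw [show m + (k + 1) + 1 = (m + k + 1) + 1 by ring, Finset.sum_range_succ, ih (by omega),
      abs_of_nonneg (by push_cast; linarith [(Nat.cast_nonneg k : (0 : ℝ) ≤ k)])]
    push_cast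
    ring

theorem sum_range_mul_mod {p q : ℕ} (hpq : Nat.Coprime p q) (hp : 0 < p) (g : ℕ → ℝ) :
    ∑ i ∈ Finset.range p, g (q * i % p) = ∑ i ∈ Finset.range p, g i := by
  have hmaps : Set.MapsTo (fun i => q * i % p) (Finset.range p) (Finset.range p) :=
    fun i _ => Finset.mem_coe.2 (Finset.mem_range.2 (Nat.mod_lt _ hp))
  have hinj : Set.InjOn (fun i => q * i % p) (Finset.range p) := by
    intro a ha b hb hab
    have h : a ≡ b [MOD p] := Nat.ModEq.cancel_left_of_coprime hpq hab
    exact h.eq_of_lt_of_lt (Finset.mem_range.1 ha) (Finset.mem_range.1 hb)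
  exact Finset.sum_nbij _ hmaps hinj
    (Finset.surjOn_of_injOn_of_card_le _ hmaps hinj le_rfl) fun _ _ => rfl

theorem sum_Icc_abs_sub_mul_div {p q i : ℕ} (hq : 0 < q) (hi : i < p) :
    ∑ j ∈ Finset.Icc 1 (q - 1), |(j : ℝ) - q * i / p| =
      (q * i / p : ℝ) ^ 2 - q * (q * i / p) + ((q * i % p : ℕ) : ℝ) / p
        - (((q * i % p : ℕ) : ℝ) / p) ^ 2 + q * (q - 1) / 2 := by
  have hp : 0 < p := by omega
  have hp' : (0 : ℝ) < p := by exact_mod_cast hp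
  have ht : (q * i / p : ℝ) = (q * i / p : ℕ) + ((q * i % p : ℕ) : ℝ) / p := by
    have h : ((p * (q * i / p) + q * i % p : ℕ) : ℝ) = (q * i : ℕ) := by rw [Nat.div_add_mod]
    rw [Nat.cast_add, Nat.cast_mul, Nat.cast_mul] at h
    field_simp
    linarith
  have hf1 : ((q * i % p : ℕ) : ℝ) / p ≤ 1 :=
    (div_le_one hp').2 (by exact_mod_cast (Nat.mod_lt _ hp).le)
  have hm : q * i / p < q := Nat.div_lt_of_lt_mul (by nlinarith)
  have hf0 : 0 ≤ ((q * i % p : ℕ) : ℝ) / p := by positivity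
  rw [sum_Icc_one_pred_eq _ hq, ht, sum_range_abs_sub hf0 hf1 hm, Nat.cast_zero, zero_sub,
    abs_neg, abs_of_nonneg (by positivity)]
  ring

theorem sum_Icc_sum_Icc_abs_sub {p q : ℕ} (hp : 0 < p) (hq : 0 < q) (hpq : Nat.Coprime p q) :
    ∑ i ∈ Finset.Icc 1 (p - 1), ∑ j ∈ Finset.Icc 1 (q - 1), |(j : ℝ) - q * i / p| =
      (p - 1) * (q * (q - 1) / 2) - (q ^ 2 - 1) * (p ^ 2 - 1) / (6 * p) := by
  have hp' : (p : ℝ) ≠ 0 := by exact_mod_cast hp.ne'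
  have hmod := sum_range_mul_mod hpq hp fun r => (r : ℝ) / p - ((r : ℝ) / p) ^ 2
  rw [sum_Icc_one_pred_eq _ hp, Finset.sum_congr rfl fun i hi =>
    sum_Icc_abs_sub_mul_div hq (Finset.mem_range.1 hi), sum_Icc_abs_sub_mul_div hq hp]
  have hsplit : ∀ i ∈ Finset.range p,
      (q * i / p : ℝ) ^ 2 - q * (q * i / p) + ((q * i % p : ℕ) : ℝ) / p
        - (((q * i % p : ℕ) : ℝ) / p) ^ 2 + q * (q - 1) / 2 =
      (q / p : ℝ) ^ 2 * (i : ℝ) ^ 2 - (q ^ 2 / p : ℝ) * i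
        + (((q * i % p : ℕ) : ℝ) / p - (((q * i % p : ℕ) : ℝ) / p) ^ 2) + q * (q - 1) / 2 := by
    intro i _
    ring
  rw [Finset.sum_congr rfl hsplit, Finset.sum_add_distrib, Finset.sum_add_distrib, hmod]
  simp only [div_pow, Finset.sum_sub_distrib, ← Finset.mul_sum, ← Finset.sum_div,
    sum_range_cast, sum_range_cast_sq, Finset.sum_const, Finset.card_range, nsmul_eq_mul]
  simp only [mul_zero, Nat.zero_mod, Nat.cast_zero]
  field_simp
  ring

theorem sum_Icc_sum_Icc_one_sub {p q : ℕ} (hp : 0 < p) (hq : 0 < q) (hpq : Nat.Coprime p q) :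
    ∑ i ∈ Finset.Icc 1 (p - 1), ∑ j ∈ Finset.Icc 1 (q - 1),
        (1 - 2 * |(i : ℝ) / p + (j : ℝ) / q - 1|) =
      (p - 1 / p) * (q - 1 / q) / 3 := by
  have hp' : (0 : ℝ) < p := by exact_mod_cast hp
  have hq' : (0 : ℝ) < q := by exact_mod_cast hq
  have hrefl : ∑ i ∈ Finset.Icc 1 (p - 1), ∑ j ∈ Finset.Icc 1 (q - 1),
        (1 - 2 * |(i : ℝ) / p + (j : ℝ) / q - 1|) =
      ∑ i ∈ Finset.Icc 1 (p - 1), ∑ j ∈ Finset.Icc 1 (q - 1),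
        (1 - 2 / q * |(j : ℝ) - q * i / p|) := by
    refine Finset.sum_nbij' (fun i => p - i) (fun i => p - i) ?_ ?_ ?_ ?_ ?_
    · intro i hi; simp only [Finset.mem_Icc] at hi ⊢; omega
    · intro i hi; simp only [Finset.mem_Icc] at hi ⊢; omega
    · intro i hi; simp only [Finset.mem_Icc] at hi; omega
    · intro i hi; simp only [Finset.mem_Icc] at hi; omega
    · intro i hi
      simp only [Finset.mem_Icc] at hi
      refine Finset.sum_congr rfl fun j _ => ?_
      rw [Nat.cast_sub (by omega : i ≤ p),
        show (j : ℝ) - q * (p - i) / p = q * ((i : ℝ) / p + (j : ℝ) / q - 1) by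
          field_simp; ring,
        abs_mul, abs_of_pos hq']
      field_simp
  rw [hrefl]
  simp only [Finset.sum_sub_distrib, ← Finset.mul_sum, sum_Icc_sum_Icc_abs_sub hp hq hpq,
    Finset.sum_const, Nat.card_Icc, nsmul_eq_mul, Nat.add_sub_cancel, Nat.cast_pred hp,
    Nat.cast_pred hq]
  field_simp
  ring


/-- The purely arithmetic form of Proposition 4.2 of the paper specialized to the
`(p,q)`-torus knot:
`0 < 3·Σ_{i=1}^{p−1} Σ_{j=1}^{q−1} (1 − 2|i/p + j/q − 1|) − (p−1)(q−1) − (p + q − p/q − q/p − 1) < 2/9`. -/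
theorem torus_arithmetic_bounds (p q : ℕ) (hp : 2 ≤ p) (hq : 2 ≤ q)
    (hpq : Nat.Coprime p q) :
    0 < 3 * (∑ i ∈ Finset.Icc 1 (p - 1), ∑ j ∈ Finset.Icc 1 (q - 1),
            (1 - 2 * |(i : ℝ) / p + (j : ℝ) / q - 1|))
        - ((p : ℝ) - 1) * ((q : ℝ) - 1)
        - ((p : ℝ) + q - (p : ℝ) / q - (q : ℝ) / p - 1) ∧
    3 * (∑ i ∈ Finset.Icc 1 (p - 1), ∑ j ∈ Finset.Icc 1 (q - 1),
            (1 - 2 * |(i : ℝ) / p + (j : ℝ) / q - 1|))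
        - ((p : ℝ) - 1) * ((q : ℝ) - 1)
        - ((p : ℝ) + q - (p : ℝ) / q - (q : ℝ) / p - 1) < 2 / 9 := by
  have hp' : (2 : ℝ) ≤ p := by exact_mod_cast hp
  have hq' : (2 : ℝ) ≤ q := by exact_mod_cast hq
  have hp0 : (0 : ℝ) < p := by linarith
  have hq0 : (0 : ℝ) < q := by linarith
  have hval : 3 * (((p : ℝ) - 1 / p) * (q - 1 / q) / 3) - ((p : ℝ) - 1) * ((q : ℝ) - 1)
      - ((p : ℝ) + q - (p : ℝ) / q - (q : ℝ) / p - 1) = 1 / (p * q) := by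
    field_simp
    ring
  rw [sum_Icc_sum_Icc_one_sub (by omega) (by omega) hpq, hval]
  have hlarge : 6 ≤ p * q := by
    have hne : p ≠ q := by
      rintro rfl
      rw [Nat.coprime_self] at hpq
      omega
    rcases Nat.lt_or_gt_of_ne hne with h | h <;> nlinarith
  have hlarge' : (6 : ℝ) ≤ p * q := by exact_mod_cast hlarge
  refine ⟨by positivity, ?_⟩
  rw [div_lt_div_iff₀ (by positivity) (by norm_num)]
  linarith
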